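/- Let A be a commutative ring equipped with a Poisson bracket, i.e. a map {·,·} : A → A → A that is additive in each argument, alternating ({a,a} = 0 for all a), satisfies the Leibniz identity {a, b·c} = {a,b}·c + b·{a,c}, and satisfies the Jacobi identity {a,{b,c}} + {b,{c,a}} + {c,{a,b}} = 0. Let φ₁,…,φ_{2n} ∈ A be such that the 2n×2n matrix W with entries W_{ij} = {φ_i,φ_j} is invertible, with inverse C. Then the Dirac bracket {f,g}_D = {f,g} − Σ_{i,j=1}^{2n} {f,φ_i}·C_{ij}·{φ_j,g} satisfies the Jacobi identity: for all f,g,h ∈ A, {f,{g,h}_D}_D + {g,{h,f}_D}_D + {h,{f,g}_D}_D = 0. -/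

import Mathlib

/-- The Dirac bracket of `f, g` with respect to constraints `φ` whose bracket matrix
has inverse `C`: `{f,g}_D = {f,g} − Σ_{i,j} {f,φ_i}·C_{ij}·{φ_j,g}`. -/
def diracBracket {A : Type*} [CommRing A] {m : ℕ} (br : A → A → A) (φ : Fin m → A)
    (C : Matrix (Fin m) (Fin m) A) (f g : A) : A :=
  br f g - ∑ i, ∑ j, br f (φ i) * C i j * br (φ j) g

theorem Derivation.lie_smul_right {A : Type*} [CommRing A] (D E : Derivation ℤ A A) (b : A) :
    ⁅D, b • E⁆ = D b • E + b • ⁅D, E⁆ := by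
  ext x
  simp only [Derivation.commutator_apply, Derivation.smul_apply, Derivation.add_apply,
    Derivation.leibniz, smul_eq_mul]
  ring

theorem Derivation.lie_smul_left {A : Type*} [CommRing A] (D E : Derivation ℤ A A) (a : A) :
    ⁅a • D, E⁆ = a • ⁅D, E⁆ - E a • D := by
  ext x
  simp only [Derivation.commutator_apply, Derivation.smul_apply, Derivation.sub_apply,
    Derivation.leibniz, smul_eq_mul]
  ring

namespace PoissonBracket

section Hamiltonian

variable {A : Type*} [CommRing A] (X : A →+ Derivation ℤ A A)

theorem antisymm (hself : ∀ f, X f f = 0) (f g : A) : X f g = -X g f := by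
  have h := hself (f + g)
  simp only [map_add, Derivation.add_apply, hself] at h
  linear_combination h

theorem hamiltonian_mul (hself : ∀ f, X f f = 0) (a b : A) :
    X (a * b) = a • X b + b • X a := by
  ext x
  simp only [Derivation.add_apply, Derivation.smul_apply, smul_eq_mul]
  rw [antisymm X hself (a * b) x, antisymm X hself b x, antisymm X hself a x,
    Derivation.leibniz]
  simp only [smul_eq_mul]
  ring

variable {ι : Type*} [Fintype ι]

/-- The Hamiltonian vector field of `f` corrected by the multipliers `a` along the
constraints `φ`. -/
def correctedField (φ : ι → A) (f : A) (a : ι → A) : Derivation ℤ A A :=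
  X f - ∑ i, a i • X (φ i)

theorem correctedField_apply (φ : ι → A) (f : A) (a : ι → A) (x : A) :
    correctedField X φ f a x = X f x - ∑ i, a i * X (φ i) x := by
  have hsum : (∑ i, a i • X (φ i)) x = ∑ i, (a i • X (φ i)) x := by
    simpa only [Derivation.coeFnAddMonoidHom_apply, Finset.sum_apply] using
      congrFun (map_sum (Derivation.coeFnAddMonoidHom (R := ℤ) (A := A) (M := A))
        (fun i => a i • X (φ i)) Finset.univ) x
  rw [correctedField, Derivation.sub_apply, hsum]
  simp only [Derivation.smul_apply, smul_eq_mul]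

theorem lie_correctedField_hamiltonian (hself : ∀ f, X f f = 0)
    (hlie : ∀ f g, ⁅X f, X g⁆ = X (X f g)) (φ : ι → A) (f : A) (a : ι → A) (u : A) :
    ⁅correctedField X φ f a, X u⁆ = X (correctedField X φ f a u) +
      ∑ i, (X (φ i) u • X (a i) + X u (a i) • X (φ i)) := by
  rw [correctedField_apply]
  simp only [correctedField, sub_lie, sum_lie, Derivation.lie_smul_left, hlie, map_sub, map_sum,
    hamiltonian_mul X hself]
  rw [sub_add, ← Finset.sum_sub_distrib]
  congr 1
  refine Finset.sum_congr rfl fun i _ => ?_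
  abel

theorem lie_correctedField (hself : ∀ f, X f f = 0)
    (hlie : ∀ f g, ⁅X f, X g⁆ = X (X f g)) (φ : ι → A) (f g : A) (a b : ι → A)
    (ha : ∀ k, correctedField X φ f a (φ k) = 0)
    (hb : ∀ k, correctedField X φ g b (φ k) = 0) :
    ⁅correctedField X φ f a, correctedField X φ g b⁆ =
      correctedField X φ (correctedField X φ f a g)
        fun j => correctedField X φ f a (b j) - correctedField X φ g b (a j) := by
  have hg (i : ι) : X (φ i) g = ∑ j, b j * X (φ i) (φ j) := by
    have h := hb i
    rw [correctedField_apply, sub_eq_zero] at h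
    rw [antisymm X hself, h, ← Finset.sum_neg_distrib]
    refine Finset.sum_congr rfl fun j _ => ?_
    rw [antisymm X hself (φ i) (φ j)]
    ring
  have hsplit : ⁅correctedField X φ f a, correctedField X φ g b⁆ =
      ⁅correctedField X φ f a, X g⁆ - ∑ j, (correctedField X φ f a (b j) • X (φ j) +
        b j • ⁅correctedField X φ f a, X (φ j)⁆) := by
    rw [show correctedField X φ g b = X g - ∑ j, b j • X (φ j) from rfl, lie_sub, lie_sum]
    simp only [Derivation.lie_smul_right]
  rw [hsplit]
  simp only [lie_correctedField_hamiltonian X hself hlie, ha, map_zero, zero_add]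
  rw [show correctedField X φ (correctedField X φ f a g) _ = _ - _ from rfl]
  simp only [correctedField_apply X φ g b, sub_smul, Finset.sum_smul, Finset.smul_sum, smul_add,
    Finset.sum_add_distrib, Finset.sum_sub_distrib, hg, smul_smul]
  rw [Finset.sum_comm (f := fun j i => (b j * X (φ i) (φ j)) • X (a i)),
    Finset.sum_comm (f := fun j i => (b j * X (φ j) (a i)) • X (φ i))]
  abel

/-- If the bracket matrix of the constraints has a right inverse, the multipliers making a
corrected field annihilate the constraints are unique. -/
theorem multiplier_unique [DecidableEq ι] (φ : ι → A) (C : Matrix ι ι A)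
    (hWC : (Matrix.of fun i j => X (φ i) (φ j)) * C = 1) (f : A) (a : ι → A)
    (ha : ∀ k, correctedField X φ f a (φ k) = 0) :
    a = Matrix.vecMul (fun i => X f (φ i)) C := by
  have h : (fun k => X f (φ k)) = Matrix.vecMul a (Matrix.of fun i j => X (φ i) (φ j)) := by
    ext k
    have hk := ha k
    rwa [correctedField_apply, sub_eq_zero] at hk
  rw [h, Matrix.vecMul_vecMul, hWC, Matrix.vecMul_one]

theorem correctedField_vecMul_constraint [DecidableEq ι] (φ : ι → A) (C : Matrix ι ι A)
    (hCW : C * (Matrix.of fun i j => X (φ i) (φ j)) = 1) (f : A) (k : ι) :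
    correctedField X φ f (Matrix.vecMul (fun i => X f (φ i)) C) (φ k) = 0 := by
  have h := congrFun (congrArg (Matrix.vecMul fun i => X f (φ i)) hCW) k
  rw [← Matrix.vecMul_vecMul, Matrix.vecMul_one] at h
  rw [correctedField_apply, sub_eq_zero]
  exact h.symm

theorem inverse_antisymm [DecidableEq ι] (hself : ∀ f, X f f = 0) (φ : ι → A)
    (C : Matrix ι ι A) (hWC : (Matrix.of fun i j => X (φ i) (φ j)) * C = 1) (i j : ι) : C i j = -C j i := by
  set W : Matrix ι ι A := Matrix.of fun i j => X (φ i) (φ j)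
  have hW : W.transpose = -W := by
    ext i j
    exact antisymm X hself (φ j) (φ i)
  have h : (-C.transpose) * W = 1 := by
    rw [Matrix.neg_mul, ← Matrix.mul_neg, ← hW, ← Matrix.transpose_mul, hWC,
      Matrix.transpose_one]
  exact congrFun (congrFun (left_inv_eq_right_inv h hWC).symm i) j

end Hamiltonian

/-- The map sending `f` to the derivation `{f, ·}`. -/
def hamiltonian {A : Type*} [CommRing A] (br : A → A → A)
    (haddl : ∀ a b c, br (a + b) c = br a c + br b c)
    (haddr : ∀ a b c, br a (b + c) = br a b + br a c)
    (hleib : ∀ a b c, br a (b * c) = br a b * c + b * br a c) : A →+ Derivation ℤ A A :=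
  AddMonoidHom.mk' (fun f => Derivation.mk' (AddMonoidHom.mk' (br f) (haddr f)).toIntLinearMap
    fun a b => by
      simp only [AddMonoidHom.coe_toIntLinearMap, AddMonoidHom.mk'_apply, smul_eq_mul, hleib]
      ring) fun a b => Derivation.ext fun c => haddl a b c

end PoissonBracket

/-- **The Dirac bracket of a Poisson bracket satisfies the Jacobi identity.**
Let `{·,·}` be a Poisson bracket on a commutative ring `A` (additive in each
argument, alternating, Leibniz, Jacobi) and `φ₁,…,φ_{2n}` constraints whose
bracket matrix `W = ({φ_i,φ_j})` is invertible with inverse `C`.  Then the Dirac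
bracket satisfies the Jacobi identity. -/
theorem dirac_bracket_jacobi (A : Type*) [CommRing A] (br : A → A → A)
    (haddl : ∀ a b c, br (a + b) c = br a c + br b c)
    (haddr : ∀ a b c, br a (b + c) = br a b + br a c)
    (halt : ∀ a, br a a = 0)
    (hleib : ∀ a b c, br a (b * c) = br a b * c + b * br a c)
    (hjac : ∀ a b c, br a (br b c) + br b (br c a) + br c (br a b) = 0)
    (n : ℕ) (φ : Fin (2 * n) → A)
    (C : Matrix (Fin (2 * n)) (Fin (2 * n)) A)
    (hWC : (Matrix.of fun i j => br (φ i) (φ j)) * C = 1)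
    (hCW : C * (Matrix.of fun i j => br (φ i) (φ j)) = 1) :
    ∀ f g h : A,
      diracBracket br φ C f (diracBracket br φ C g h) +
      diracBracket br φ C g (diracBracket br φ C h f) +
      diracBracket br φ C h (diracBracket br φ C f g) = 0 := by
  let X := PoissonBracket.hamiltonian br haddl haddr hleib
  have hX (f g : A) : X f g = br f g := rfl
  have hanti := PoissonBracket.antisymm X halt
  have hlie (f g : A) : ⁅X f, X g⁆ = X (X f g) := by
    ext h
    have h₁ : br g (br h f) = -br g (br f h) := by
      have := map_neg (X g) (br f h)
      rwa [← hX f h, ← hanti h f] at this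
    have h₂ : br h (br f g) = -br (br f g) h := hanti _ _
    simp only [Derivation.commutator_apply, hX]
    linear_combination hjac f g h - h₁ - h₂
  let m (f : A) : Fin (2 * n) → A := Matrix.vecMul (fun i => X f (φ i)) C
  let D (f : A) : Derivation ℤ A A := PoissonBracket.correctedField X φ f (m f)
  have hD (f g : A) : diracBracket br φ C f g = D f g := by
    rw [PoissonBracket.correctedField_apply, diracBracket, Finset.sum_comm]
    simp only [m, Matrix.vecMul, dotProduct, Finset.sum_mul, hX]
  have hDφ (f : A) (k : Fin (2 * n)) : D f (φ k) = 0 :=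
    PoissonBracket.correctedField_vecMul_constraint X φ C hCW f k
  have hDanti (f g : A) : D f g = -D g f := by
    rw [← hD, ← hD, diracBracket, diracBracket, neg_sub', ← Finset.sum_neg_distrib,
      Finset.sum_comm]
    have h₀ : br f g = -br g f := hanti f g
    rw [h₀]
    congr 1
    refine Finset.sum_congr rfl fun j _ => ?_
    rw [← Finset.sum_neg_distrib]
    refine Finset.sum_congr rfl fun i _ => ?_
    have h₁ : br f (φ i) = -br (φ i) f := hanti _ _
    have h₂ : br (φ j) g = -br g (φ j) := hanti _ _
    rw [h₁, h₂, PoissonBracket.inverse_antisymm X halt φ C hWC i j]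
    ring
  have hDlie (f g : A) : ⁅D f, D g⁆ = D (D f g) := by
    have h := PoissonBracket.lie_correctedField X halt hlie φ f g (m f) (m g) (hDφ f) (hDφ g)
    have hm := PoissonBracket.multiplier_unique X φ C hWC (D f g)
      (fun j => D f (m g j) - D g (m f j)) fun k => by
        rw [← h, Derivation.commutator_apply, hDφ, hDφ, map_zero, map_zero, sub_zero]
    exact h.trans (congrArg _ hm)
  intro f g h
  simp only [hD]
  have hfg := congrArg (fun E : Derivation ℤ A A => E h) (hDlie f g)
  simp only [Derivation.commutator_apply] at hfg
  rw [hDanti h f, map_neg, hDanti h (D f g), ← hfg]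
  ring
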